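/- Let G = (M, w₀, φ₀, Γ) be a Γ-bounded evaluation game and let ψ₁, …, ψ_k be the μν-subformula occurrences lying, in this order starting from the root, on a single branch of the syntax tree of φ₀. If in a play of G a position with clock mapping c' occurs later than a position with clock mapping c, then (c'(ψ₁), …, c'(ψ_k)) ⪯ (c(ψ₁), …, c(ψ_k)) in the lexicographic order on k-tuples of ordinals. -/

import Mathlib

/-- Formulae of the modal μ-calculus, with negation only on proposition symbols:
`φ ::= p | ¬p | X | φ∨φ | φ∧φ | ◇φ | □φ | μX φ | νX φ`. -/
inductive Formula (Φ Λ : Type) : Type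
  | atom  : Φ → Formula Φ Λ
  | natom : Φ → Formula Φ Λ
  | label : Λ → Formula Φ Λ
  | or    : Formula Φ Λ → Formula Φ Λ → Formula Φ Λ
  | and   : Formula Φ Λ → Formula Φ Λ → Formula Φ Λ
  | dia   : Formula Φ Λ → Formula Φ Λ
  | box   : Formula Φ Λ → Formula Φ Λ
  | mu    : Λ → Formula Φ Λ → Formula Φ Λ
  | nu    : Λ → Formula Φ Λ → Formula Φ Λ

/-- A Kripke model `M = (W,R,V)` over the (nonempty) set `W` of worlds. -/
structure Kripke (Φ W : Type) where
  R : W → W → Prop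
  V : Φ → Set W

variable {Φ Λ W : Type}
/-- The set of label symbols occurring free in a formula. -/
def freeLabels : Formula Φ Λ → Set Λ
  | .atom _ => ∅
  | .natom _ => ∅
  | .label X => {X}
  | .or φ ψ => freeLabels φ ∪ freeLabels ψ
  | .and φ ψ => freeLabels φ ∪ freeLabels ψ
  | .dia φ => freeLabels φ
  | .box φ => freeLabels φ
  | .mu X φ => freeLabels φ \ {X}
  | .nu X φ => freeLabels φ \ {X}

/-- A sentence is a formula with no free label symbols. -/
def IsSentence (φ : Formula Φ Λ) : Prop := freeLabels φ = ∅

/-- The list of label symbols bound by the μ- and ν-operator occurrences of a formula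
(with multiplicity). -/
def binderList : Formula Φ Λ → List Λ
  | .atom _ => []
  | .natom _ => []
  | .label _ => []
  | .or φ ψ => binderList φ ++ binderList ψ
  | .and φ ψ => binderList φ ++ binderList ψ
  | .dia φ => binderList φ
  | .box φ => binderList φ
  | .mu X φ => X :: binderList φ
  | .nu X φ => X :: binderList φ

/-- A formula is in normal form if each label symbol occurs at most once bound by a
μ- or ν-operator in it. -/
def NormalForm (φ : Formula Φ Λ) : Prop := (binderList φ).Nodup
open scoped Classical

/-- The two players of the evaluation game. -/
inductive Player : Type
  | eloise
  | abelard
deriving DecidableEq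

/-- A position `(w, φ, c)` of a Γ-bounded evaluation game for a sentence `φ₀`: a world `w`,
an occurrence of a subformula of `φ₀` (represented by its address `addr` in the syntax tree
of `φ₀`), and a clock mapping `c` assigning ordinals to (addresses of) subformula
occurrences of `φ₀`. -/
structure GPos (W : Type) where
  world : W
  addr : List ℕ
  clock : List ℕ → Ordinal

/-- The subformula occurrence of `φ` at address `o` in its syntax tree
(`0` = left/unique child, `1` = right child), if any. -/
def nodeAt : Formula Φ Λ → List ℕ → Option (Formula Φ Λ)
  | φ, [] => some φ
  | .or φ _, 0 :: t => nodeAt φ t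
  | .or _ ψ, 1 :: t => nodeAt ψ t
  | .and φ _, 0 :: t => nodeAt φ t
  | .and _ ψ, 1 :: t => nodeAt ψ t
  | .dia φ, 0 :: t => nodeAt φ t
  | .box φ, 0 :: t => nodeAt φ t
  | .mu _ φ, 0 :: t => nodeAt φ t
  | .nu _ φ, 0 :: t => nodeAt φ t
  | _, _ => none

/-- Whether the occurrence at address `o` in `φ₀` is a μν-subformula occurrence. -/
def muNuAt (φ₀ : Formula Φ Λ) (o : List ℕ) : Bool :=
  match nodeAt φ₀ o with
  | some (.mu _ _) => true
  | some (.nu _ _) => true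
  | _ => false

/-- Whether the occurrence at address `o` in `φ₀` is of the form `μX ψ` or `νX ψ`. -/
def bindsAt [DecidableEq Λ] (φ₀ : Formula Φ Λ) (X : Λ) (o : List ℕ) : Bool :=
  match nodeAt φ₀ o with
  | some (.mu Y _) => decide (Y = X)
  | some (.nu Y _) => decide (Y = X)
  | _ => false

/-- The (address of the) reference formula `rf(X)` of an occurrence of the label `X`
at address `o` in `φ₀`: the innermost (longest) binder `μX ψ` / `νX ψ` on the branch
from the root to `o`. -/
def refOcc [DecidableEq Λ] (φ₀ : Formula Φ Λ) (X : Λ) (o : List ℕ) : Option (List ℕ) :=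
  (o.inits.filter (fun o' => bindsAt φ₀ X o')).getLast?

/-- The player (if any) to move at a position: Eloise resolves `∨`, `◇`, `μ` and labels
bound by `μ`; Abelard resolves `∧`, `□`, `ν` and labels bound by `ν`; nobody moves at
literals. -/
def turn [DecidableEq Λ] (φ₀ : Formula Φ Λ) (p : GPos W) : Option Player :=
  match nodeAt φ₀ p.addr with
  | some (.or _ _) => some .eloise
  | some (.and _ _) => some .abelard
  | some (.dia _) => some .eloise
  | some (.box _) => some .abelard
  | some (.mu _ _) => some .eloise
  | some (.nu _ _) => some .abelard
  | some (.label X) =>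
      match (refOcc φ₀ X p.addr).bind (nodeAt φ₀) with
      | some (.mu _ _) => some .eloise
      | some (.nu _ _) => some .abelard
      | _ => none
  | _ => none

/-- The clock mapping after a move at a label occurrence whose reference formula sits at
address `r`: the clock of `r` becomes `γ'`, clocks of all μν-subformula occurrences of the
body of the reference formula are reset to `Γ`, all other clocks are unchanged. -/
def clockReset (Γ γ' : Ordinal) (r : List ℕ) (c : List ℕ → Ordinal) : List ℕ → Ordinal :=
  fun o => if o = r then γ' else if (r ++ [0]).isPrefixOf o then Γ else c o

/-- The set of positions reachable from `p` in one round of the Γ-bounded evaluation game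
for `φ₀` on `M`, according to the rules of the game. -/
def moves [DecidableEq Λ] (M : Kripke Φ W) (φ₀ : Formula Φ Λ) (Γ : Ordinal)
    (p : GPos W) : Set (GPos W) :=
  match nodeAt φ₀ p.addr with
  | some (.or _ _) => {⟨p.world, p.addr ++ [0], p.clock⟩, ⟨p.world, p.addr ++ [1], p.clock⟩}
  | some (.and _ _) => {⟨p.world, p.addr ++ [0], p.clock⟩, ⟨p.world, p.addr ++ [1], p.clock⟩}
  | some (.dia _) => {q | ∃ v, M.R p.world v ∧ q = ⟨v, p.addr ++ [0], p.clock⟩}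
  | some (.box _) => {q | ∃ v, M.R p.world v ∧ q = ⟨v, p.addr ++ [0], p.clock⟩}
  | some (.mu _ _) =>
      {q | ∃ γ < Γ, q = ⟨p.world, p.addr ++ [0], Function.update p.clock p.addr γ⟩}
  | some (.nu _ _) =>
      {q | ∃ γ < Γ, q = ⟨p.world, p.addr ++ [0], Function.update p.clock p.addr γ⟩}
  | some (.label X) =>
      match refOcc φ₀ X p.addr with
      | some r => {q | ∃ γ' < p.clock r, q = ⟨p.world, r ++ [0], clockReset Γ γ' r p.clock⟩}
      | none => ∅
  | _ => ∅

/-- The winner of the game at an ending position: at `(w,p,c)` Eloise wins iff `w ∈ V(p)`,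
at `(w,¬p,c)` iff `w ∉ V(p)`; at any other position with no available moves, the player
who should move loses (so Abelard wins at `◇` with no successor and at labels bound by `μ`
with clock value `0`, and dually for Eloise). -/
noncomputable def winsTerminal [DecidableEq Λ] (M : Kripke Φ W) (φ₀ : Formula Φ Λ)
    (p : GPos W) : Player :=
  match nodeAt φ₀ p.addr with
  | some (.atom q) => if p.world ∈ M.V q then .eloise else .abelard
  | some (.natom q) => if p.world ∈ M.V q then .abelard else .eloise
  | _ =>
      match turn φ₀ p with
      | some .eloise => .abelard
      | _ => .eloise

/-- The initial position `(w₀, φ₀, c₀)` of the game, where `c₀` is constantly `Γ`. -/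
def initPos (w₀ : W) (Γ : Ordinal) : GPos W := ⟨w₀, [], fun _ => Γ⟩

/-- `ConsPlay M φ₀ Γ w₀ P σ f` : the finite sequence of positions `f` is a (partial) play of
the Γ-bounded evaluation game `(M, w₀, φ₀, Γ)` in which player `P` follows the positional
strategy `σ`: it starts at the initial position, every step obeys the rules of the game,
and at every position where `P` moves, the move is the one prescribed by `σ`. -/
def ConsPlay [DecidableEq Λ] (M : Kripke Φ W) (φ₀ : Formula Φ Λ) (Γ : Ordinal) (w₀ : W)
    (P : Player) (σ : GPos W → GPos W) (f : List (GPos W)) : Prop :=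
  f.head? = some (initPos w₀ Γ) ∧
    ∀ i, (h : i + 1 < f.length) →
      f[i + 1] ∈ moves M φ₀ Γ (f[i]'(Nat.lt_of_succ_lt h)) ∧
        (turn φ₀ (f[i]'(Nat.lt_of_succ_lt h)) = some P →
          f[i + 1] = σ (f[i]'(Nat.lt_of_succ_lt h)))

/-- `WinStrat M φ₀ Γ w₀ P σ` : the (positional) strategy `σ` is a winning strategy for
player `P` in the Γ-bounded evaluation game `(M, w₀, φ₀, Γ)`: along any play in which `P`
follows `σ`, whenever it is `P`'s turn and some move is available, `σ` prescribes a legal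
move (so `P` can always continue playing according to `σ`), and every ending position ever
reached is winning for `P`. -/
noncomputable def WinStrat [DecidableEq Λ] (M : Kripke Φ W) (φ₀ : Formula Φ Λ)
    (Γ : Ordinal) (w₀ : W) (P : Player) (σ : GPos W → GPos W) : Prop :=
  ∀ f, ConsPlay M φ₀ Γ w₀ P σ f → ∀ p, f.getLast? = some p →
    (turn φ₀ p = some P → (moves M φ₀ Γ p).Nonempty → σ p ∈ moves M φ₀ Γ p) ∧
      (moves M φ₀ Γ p = ∅ → winsTerminal M φ₀ p = P)

/-- A leaf of the syntax tree: a literal or a label symbol. -/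
def IsLeaf : Formula Φ Λ → Prop
  | .atom _ => True
  | .natom _ => True
  | .label _ => True
  | _ => False

theorem List.pairwise_length_lt_inits {α : Type*} (l : List α) :
    l.inits.Pairwise (fun s t => s.length < t.length) := by
  induction l with
  | nil => simp
  | cons a l ih =>
    rw [List.inits_cons, List.pairwise_cons]
    refine ⟨by simp, ?_⟩
    rw [List.pairwise_map]
    exact ih.imp (by simp)

/-- If `g` lies strictly below `h` at `r` and agrees with `h` at every element not having `r`
as a prefix, then on a list of increasing length containing `r` the values of `g` are
lexicographically below those of `h`. -/
theorem List.lex_map_of_lt_of_eq {α β : Type*} {R : β → β → Prop} {g h : List α → β}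
    {r : List α} (hr : R (g r) (h r)) (heq : ∀ o, ¬ r <+: o → g o = h o)
    {L : List (List α)} (hL : L.Pairwise (fun s t => s.length < t.length)) (hmem : r ∈ L) :
    List.Lex R (L.map g) (L.map h) := by
  induction L with
  | nil => simp at hmem
  | cons o L ih =>
    rw [List.pairwise_cons] at hL
    rcases List.mem_cons.1 hmem with rfl | hmem
    · exact .rel hr
    · have ho : g o = h o := heq o fun hp =>
        (hL.1 r hmem).not_ge hp.length_le
      rw [List.map_cons, List.map_cons, ho]
      exact .cons (ih hL.2 hmem)

/-- Along a branch, changing the clocks so that they decrease at a μν-occurrence `r` and stay the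
same outside of the subtree at `r` does not increase the tuple of clock values. -/
theorem lex_or_eq_of_clock_lt {φ₀ : Formula Φ Λ} {c c' : List ℕ → Ordinal} {r : List ℕ}
    (b : List ℕ) (hr : muNuAt φ₀ r = true) (hlt : c' r < c r)
    (heq : ∀ o, ¬ r <+: o → c' o = c o) :
    List.Lex (· < ·) ((b.inits.filter (fun o => muNuAt φ₀ o)).map c')
        ((b.inits.filter (fun o => muNuAt φ₀ o)).map c) ∨
      (b.inits.filter (fun o => muNuAt φ₀ o)).map c' =
        (b.inits.filter (fun o => muNuAt φ₀ o)).map c := by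
  by_cases hrb : r <+: b
  · left
    refine List.lex_map_of_lt_of_eq hlt heq ((List.pairwise_length_lt_inits b).filter _) ?_
    simpa [hr] using hrb
  · right
    refine List.map_congr_left fun o ho => heq o fun hp => hrb ?_
    exact hp.trans ((List.mem_inits _ _).1 (List.mem_filter.1 ho).1)

theorem muNuAt_of_refOcc [DecidableEq Λ] {φ₀ : Formula Φ Λ} {X : Λ} {o r : List ℕ}
    (h : refOcc φ₀ X o = some r) : muNuAt φ₀ r = true := by
  have hb := (List.mem_filter.1 (List.mem_of_getLast? h)).2
  unfold bindsAt at hb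
  unfold muNuAt
  split at hb <;> simp_all

/-- A move changes the clocks not at all, or decreases the clock of some μν-occurrence `r` while
affecting no clock outside of the subtree at `r`, provided that the current occurrence and all
those below it have the clock value `Γ`. -/
theorem clock_eq_or_lt_of_mem_moves [DecidableEq Λ] {M : Kripke Φ W} {φ₀ : Formula Φ Λ}
    {Γ : Ordinal} {p q : GPos W} (hp : ∀ o, p.addr <+: o → p.clock o = Γ)
    (hq : q ∈ moves M φ₀ Γ p) :
    q.clock = p.clock ∨ ∃ r, muNuAt φ₀ r = true ∧ q.clock r < p.clock r ∧
      ∀ o, ¬ r <+: o → q.clock o = p.clock o := by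
  have fixpoint (hmu : muNuAt φ₀ p.addr = true)
      (hq : ∃ γ < Γ, q = ⟨p.world, p.addr ++ [0], Function.update p.clock p.addr γ⟩) :
      ∃ r, muNuAt φ₀ r = true ∧ q.clock r < p.clock r ∧
        ∀ o, ¬ r <+: o → q.clock o = p.clock o := by
    obtain ⟨γ, hγ, rfl⟩ := hq
    refine ⟨p.addr, hmu, by simpa [hp _ List.prefix_rfl] using hγ, fun o ho => ?_⟩
    exact Function.update_of_ne (by rintro rfl; exact ho List.prefix_rfl) _ _
  unfold moves at hq
  split at hq
  · left; rcases hq with rfl | rfl <;> rfl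
  · left; rcases hq with rfl | rfl <;> rfl
  · left; obtain ⟨v, -, rfl⟩ := hq; rfl
  · left; obtain ⟨v, -, rfl⟩ := hq; rfl
  · next h => exact .inr (fixpoint (by simp [muNuAt, h]) hq)
  · next h => exact .inr (fixpoint (by simp [muNuAt, h]) hq)
  · split at hq
    · next r hr =>
      obtain ⟨γ, hγ, rfl⟩ := hq
      refine .inr ⟨r, muNuAt_of_refOcc hr, by simpa [clockReset] using hγ, fun o ho => ?_⟩
      have hne : o ≠ r := by rintro rfl; exact ho List.prefix_rfl
      have hpre : ¬ (r ++ [0]) <+: o := fun h => ho ((List.prefix_append _ _).trans h)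
      simp [clockReset, hne, hpre]
    · exact hq.elim
  · exact hq.elim

/-- Moves preserve the property that the current occurrence and all those below it have the
clock value `Γ`. -/
theorem clock_eq_of_mem_moves [DecidableEq Λ] {M : Kripke Φ W} {φ₀ : Formula Φ Λ}
    {Γ : Ordinal} {p q : GPos W} (hp : ∀ o, p.addr <+: o → p.clock o = Γ)
    (hq : q ∈ moves M φ₀ Γ p) : ∀ o, q.addr <+: o → q.clock o = Γ := by
  have ne_of_prefix {r o : List ℕ} (h : (r ++ [0]) <+: o) : o ≠ r := by
    rintro rfl
    simpa using h.length_le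
  have child (i : ℕ) (o : List ℕ) (h : (p.addr ++ [i]) <+: o) : p.clock o = Γ :=
    hp o ((List.prefix_append _ _).trans h)
  have fixpoint
      (hq : ∃ γ < Γ, q = ⟨p.world, p.addr ++ [0], Function.update p.clock p.addr γ⟩) :
      ∀ o, q.addr <+: o → q.clock o = Γ := by
    obtain ⟨γ, -, rfl⟩ := hq
    intro o ho
    exact (Function.update_of_ne (ne_of_prefix ho) _ _).trans (child 0 o ho)
  unfold moves at hq
  split at hq
  · rcases hq with rfl | rfl <;> exact child _
  · rcases hq with rfl | rfl <;> exact child _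
  · obtain ⟨v, -, rfl⟩ := hq; exact child _
  · obtain ⟨v, -, rfl⟩ := hq; exact child _
  · exact fixpoint hq
  · exact fixpoint hq
  · split at hq
    · obtain ⟨γ, -, rfl⟩ := hq
      intro o ho
      have hne := ne_of_prefix ho
      simp only at ho
      simp [clockReset, hne, ho]
    · exact hq.elim
  · exact hq.elim

/-- Let `b` be (the address of a leaf determining) a branch of the syntax tree
of `φ₀` and let `ψ₁, …, ψ_k` be the μν-subformula occurrences on this branch, in this order
starting from the root (here: the list of addresses `o` of μν-occurrences among the
prefixes of `b`, ordered by increasing length).  If in a play of the Γ-bounded evaluation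
game `(M, w₀, φ₀, Γ)` a position with clock mapping `c'` occurs later than a position with
clock mapping `c`, then `(c'(ψ₁), …, c'(ψ_k)) ⪯ (c(ψ₁), …, c(ψ_k))` in the lexicographic
order on k-tuples of ordinals. -/
theorem clock_tuples_lex_decrease [DecidableEq Λ] [Nonempty W] (M : Kripke Φ W) (w₀ : W)
    (φ₀ : Formula Φ Λ) (hφ : IsSentence φ₀) (Γ : Ordinal)
    (b : List ℕ) (ψb : Formula Φ Λ) (hb : nodeAt φ₀ b = some ψb) (hleaf : IsLeaf ψb)
    (f : List (GPos W)) (hhead : f.head? = some (initPos w₀ Γ))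
    (hsteps : ∀ i, (h : i + 1 < f.length) →
      f[i + 1] ∈ moves M φ₀ Γ (f[i]'(Nat.lt_of_succ_lt h)))
    (m n : ℕ) (hmn : m < n) (hn : n < f.length) :
    List.Lex (· < ·)
        ((b.inits.filter (fun o => muNuAt φ₀ o)).map (f[n]).clock)
        ((b.inits.filter (fun o => muNuAt φ₀ o)).map (f[m]'(lt_trans hmn hn)).clock) ∨
      ((b.inits.filter (fun o => muNuAt φ₀ o)).map (f[n]).clock) =
        ((b.inits.filter (fun o => muNuAt φ₀ o)).map (f[m]'(lt_trans hmn hn)).clock) := by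
  have hinv : ∀ i, (h : i < f.length) → ∀ o, f[i].addr <+: o → f[i].clock o = Γ := by
    intro i
    induction i with
    | zero =>
      intro h o _
      have h0 : f[0] = initPos w₀ Γ := by
        rw [List.head?_eq_getElem?, List.getElem?_eq_getElem h] at hhead
        exact Option.some.inj hhead
      rw [h0, initPos]
    | succ i ih => exact fun h => clock_eq_of_mem_moves (ih (by lia)) (hsteps i h)
  have step : ∀ i, (h : i + 1 < f.length) →
      List.Lex (· < ·) ((b.inits.filter (fun o => muNuAt φ₀ o)).map (f[i + 1]).clock)
          ((b.inits.filter (fun o => muNuAt φ₀ o)).map (f[i]).clock) ∨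
        (b.inits.filter (fun o => muNuAt φ₀ o)).map (f[i + 1]).clock =
          (b.inits.filter (fun o => muNuAt φ₀ o)).map (f[i]).clock := by
    intro i h
    rcases clock_eq_or_lt_of_mem_moves (hinv i (by lia)) (hsteps i h) with
      he | ⟨r, hr, hlt, heq⟩
    · exact .inr (by rw [he])
    · exact lex_or_eq_of_clock_lt b hr hlt heq
  induction n, hmn using Nat.le_induction with
  | base => exact step m hn
  | succ n hmn ih =>
    rcases step n hn with h₁ | h₁
    · left
      rcases ih (by lia) step with h₂ | h₂
      · exact List.lex_trans (fun h h' => lt_trans h h') h₁ h₂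
      · rwa [← h₂]
    · rw [h₁]
      exact ih (by lia) step
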